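/- arXiv:2201.11570 — 2 statements merged into one kernel-verified Lean document; each statement's English description precedes it below -/
import Mathlib

section
/- Let n ≥ 1 and let x₁,...,x_{2n} be real numbers. Define the triangular array a_{i,j} = cos(x_i − x_j) for 1 ≤ i < j ≤ 2n, and let pf_{2n} = Σ_{σ ∈ S_{2n,pf}} sign(σ) · a_{i₁,j₁}···a_{iₙ,jₙ}, where S_{2n,pf} is the set of permutations (i₁,j₁,...,iₙ,jₙ) of {1,...,2n} with i₁ < i₂ < ... < iₙ and i_s < j_s for all s. Then pf_{2n} = cos(x₁ − x₂ + x₃ − x₄ + ... + x_{2n-1} − x_{2n}). -/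
open Finset

/-- The set of Pfaff permutations of `{0, ..., 2n-1}`: written in one line as
`(i₁, j₁, ..., iₙ, jₙ)` with `i₁ < i₂ < ⋯ < iₙ` and `iₛ < jₛ` for all `s`. -/
def pfaffPerms (n : ℕ) : Finset (Equiv.Perm (Fin (2*n))) :=
  Finset.univ.filter fun σ =>
    (∀ k : Fin n, σ ⟨2*k.1, by have := k.2; omega⟩ < σ ⟨2*k.1+1, by have := k.2; omega⟩) ∧
    ∀ k l : Fin n, k < l →
      σ ⟨2*k.1, by have := k.2; omega⟩ < σ ⟨2*l.1, by have := l.2; omega⟩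

/-- The Pfaffian of a triangular array `(a i j)_{i<j}`:
the alternating sum over Pfaff permutations of the products `a i₁ j₁ ⋯ a iₙ jₙ`. -/
def pf (n : ℕ) {R : Type*} [CommRing R] (a : Fin (2*n) → Fin (2*n) → R) : R :=
  ∑ σ ∈ pfaffPerms n,
    ((Equiv.Perm.sign σ : ℤ) : R) *
      ∏ k : Fin n, a (σ ⟨2*k.1, by have := k.2; omega⟩) (σ ⟨2*k.1+1, by have := k.2; omega⟩)

/-- The permutation `0, j + 1, …` of `Fin (m + 2)` whose remaining entries are those of `τ`,
relabelled in increasing order so as to avoid `0` and `j + 1`. -/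
def consPair {m : ℕ} (j : Fin (m + 1)) (τ : Equiv.Perm (Fin m)) : Equiv.Perm (Fin (m + 2)) :=
  Equiv.Perm.decomposeFin.symm (0, j.cycleRange.symm * Equiv.Perm.decomposeFin.symm (0, τ))

section consPair

variable {m : ℕ} (j : Fin (m + 1)) (τ : Equiv.Perm (Fin m))

theorem consPair_zero : consPair j τ 0 = 0 := by
  simp [consPair]

theorem consPair_one : consPair j τ (Fin.succ 0) = j.succ := by
  rw [consPair, Equiv.Perm.decomposeFin_symm_apply_succ]
  simp

theorem consPair_succ_succ (i : Fin m) :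
    consPair j τ i.succ.succ = (j.succAbove (τ i)).succ := by
  rw [consPair, Equiv.Perm.decomposeFin_symm_apply_succ]
  simp

theorem sign_consPair :
    Equiv.Perm.sign (consPair j τ) = (-1) ^ (j : ℕ) * Equiv.Perm.sign τ := by
  simp [consPair, Fin.sign_cycleRange]

end consPair

theorem consPair_injective {m : ℕ} :
    Function.Injective fun p : Fin (m + 1) × Equiv.Perm (Fin m) => consPair p.1 p.2 := by
  rintro ⟨j, τ⟩ ⟨j', τ'⟩ h
  have hj : j = j' := by
    have := congrArg (fun σ => σ (Fin.succ 0)) h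
    simpa only [consPair_one, Fin.succ_inj] using this
  subst hj
  simpa [consPair] using h

theorem exists_consPair_eq {m : ℕ} (σ : Equiv.Perm (Fin (m + 2))) (hσ : σ 0 = 0) :
    ∃ j τ, consPair j τ = σ := by
  have fix_zero : ∀ {k : ℕ} (ρ : Equiv.Perm (Fin (k + 1))), ρ 0 = 0 →
      ∃ τ, Equiv.Perm.decomposeFin.symm (0, τ) = ρ := by
    intro k ρ hρ
    obtain ⟨⟨p, τ⟩, rfl⟩ := Equiv.Perm.decomposeFin.symm.surjective ρ
    rw [Equiv.Perm.decomposeFin_symm_apply_zero] at hρ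
    exact ⟨τ, by rw [hρ]⟩
  obtain ⟨ρ, rfl⟩ := fix_zero σ hσ
  obtain ⟨τ, hτ⟩ := fix_zero ((ρ 0).cycleRange * ρ) (by simp)
  refine ⟨ρ 0, τ, ?_⟩
  rw [consPair, hτ]
  congr 2
  ext i
  simp

theorem consPair_mem_pfaffPerms {n : ℕ} (j : Fin (2 * n + 1)) (τ : Equiv.Perm (Fin (2 * n))) :
    consPair j τ ∈ pfaffPerms (n + 1) ↔ τ ∈ pfaffPerms n := by
  have h0 := consPair_zero j τ
  have h1 := consPair_one j τ
  have h2 : ∀ (i : ℕ) (hi : i < 2 * n),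
      consPair j τ ⟨i + 2, by omega⟩ = (j.succAbove (τ ⟨i, hi⟩)).succ :=
    fun i hi => consPair_succ_succ j τ ⟨i, hi⟩
  simp only [pfaffPerms, mem_filter, mem_univ, true_and]
  constructor
  · rintro ⟨hpair, hmono⟩
    refine ⟨fun k => ?_, fun k l hkl => ?_⟩
    · have := hpair k.succ
      erw [h2 (2 * k.1) (by omega), h2 (2 * k.1 + 1) (by omega)] at this
      simpa using this
    · have := hmono k.succ l.succ (by simpa using hkl)
      erw [h2 (2 * k.1) (by omega), h2 (2 * l.1) (by omega)] at this
      simpa using this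
  · rintro ⟨hpair, hmono⟩
    refine ⟨fun k => ?_, fun k l hkl => ?_⟩
    · cases k using Fin.cases with
      | zero =>
        erw [h0, h1]
        exact Fin.succ_pos _
      | succ k =>
        erw [h2 (2 * k.1) (by omega), h2 (2 * k.1 + 1) (by omega)]
        simpa using hpair k
    · cases l using Fin.cases with
      | zero => exact absurd hkl (Fin.not_lt_zero k)
      | succ l =>
        erw [h2 (2 * l.1) (by omega)]
        cases k using Fin.cases with
        | zero =>
          erw [h0]
          exact Fin.succ_pos _
        | succ k =>
          erw [h2 (2 * k.1) (by omega)]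
          simpa using hmono k l (by simpa using hkl)

theorem apply_zero_of_mem_pfaffPerms {n : ℕ} {σ : Equiv.Perm (Fin (2 * n + 2))}
    (hσ : σ ∈ pfaffPerms (n + 1)) : σ 0 = 0 := by
  simp only [pfaffPerms, mem_filter, mem_univ, true_and] at hσ
  obtain ⟨hpair, hmono⟩ := hσ
  obtain ⟨⟨p, hp⟩, hp0⟩ := σ.surjective 0
  obtain ⟨k, rfl | rfl⟩ := Nat.even_or_odd' p
  · rcases Nat.eq_zero_or_pos k with rfl | hk
    · exact hp0
    · have := hmono ⟨0, by omega⟩ ⟨k, by omega⟩ hk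
      erw [hp0] at this
      exact absurd this (Fin.not_lt_zero _)
  · have := hpair ⟨k, by omega⟩
    erw [hp0] at this
    exact absurd this (Fin.not_lt_zero _)

/-- Expansion of the Pfaffian along the first row. -/
theorem pf_succ (n : ℕ) {R : Type*} [CommRing R] (a : Fin (2 * n + 2) → Fin (2 * n + 2) → R) :
    pf (n + 1) a = ∑ j : Fin (2 * n + 1), (-1) ^ (j : ℕ) * a 0 j.succ *
      pf n fun i k => a (j.succAbove i).succ (j.succAbove k).succ := by
  simp only [pf, mul_sum]
  rw [← sum_product' univ (pfaffPerms n)]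
  symm
  refine sum_bij (fun p _ => consPair p.1 p.2) ?_ ?_ ?_ ?_
  · rintro ⟨j, τ⟩ h
    exact (consPair_mem_pfaffPerms j τ).2 (mem_product.1 h).2
  · intro p _ q _ h
    exact consPair_injective h
  · intro σ hσ
    obtain ⟨j, τ, rfl⟩ := exists_consPair_eq σ (apply_zero_of_mem_pfaffPerms hσ)
    exact ⟨(j, τ), mem_product.2 ⟨mem_univ _, (consPair_mem_pfaffPerms j τ).1 hσ⟩, rfl⟩
  · rintro ⟨j, τ⟩ -
    have h2 : ∀ (i : ℕ) (hi : i < 2 * n),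
        consPair j τ ⟨i + 2, by omega⟩ = (j.succAbove (τ ⟨i, hi⟩)).succ :=
      fun i hi => consPair_succ_succ j τ ⟨i, hi⟩
    have hprod : ∏ k : Fin (n + 1), a (consPair j τ ⟨2 * k.1, by omega⟩)
          (consPair j τ ⟨2 * k.1 + 1, by omega⟩) =
        a 0 j.succ * ∏ k : Fin n, a (j.succAbove (τ ⟨2 * k.1, by omega⟩)).succ
          (j.succAbove (τ ⟨2 * k.1 + 1, by omega⟩)).succ := by
      rw [Fin.prod_univ_succ]
      congr 1
      · exact congrArg₂ a (consPair_zero j τ) (consPair_one j τ)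
      · exact prod_congr rfl fun k _ =>
          congrArg₂ a (h2 (2 * k.1) (by omega)) (h2 (2 * k.1 + 1) (by omega))
    refine Eq.trans ?_ (congrArg₂ (· * ·)
      (congrArg (fun s : ℤˣ => ((s : ℤ) : R)) (sign_consPair j τ).symm) hprod.symm)
    push_cast
    ring

theorem sum_alternating_skip (y : ℕ → ℝ) {j m : ℕ} (hjm : j ≤ m) :
    ∑ i ∈ range m, (-1) ^ i * y (if i < j then i else i + 1) =
      ∑ i ∈ range j, (-1) ^ i * y i + ∑ i ∈ range (j + 1), (-1) ^ i * y i -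
        ∑ i ∈ range (m + 1), (-1) ^ i * y i := by
  induction m, hjm using Nat.le_induction with
  | base =>
    rw [add_sub_cancel_right]
    exact sum_congr rfl fun i hi => by rw [if_pos (mem_range.1 hi)]
  | succ m hjm ih =>
    rw [sum_range_succ, ih, sum_range_succ _ (m + 1), if_neg (by omega)]
    ring

theorem sum_cos_telescope (y : ℕ → ℝ) (t P : ℝ) (n : ℕ) :
    ∑ j ∈ range (2 * n + 1), (-1) ^ j * Real.cos (t - y j) *
        Real.cos (∑ i ∈ range j, (-1) ^ i * y i + ∑ i ∈ range (j + 1), (-1) ^ i * y i - P) =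
      (Real.cos (t - P) +
        Real.cos (t + P - 2 * ∑ i ∈ range (2 * n + 1), (-1) ^ i * y i)) / 2 := by
  have prod_cos : ∀ u v : ℝ,
      Real.cos u * Real.cos v = (Real.cos (u + v) + Real.cos (u - v)) / 2 := by
    intro u v
    rw [Real.cos_add, Real.cos_sub]
    ring
  induction n with
  | zero =>
    simp only [mul_zero, zero_add, sum_range_one, sum_range_zero, pow_zero, one_mul, prod_cos]
    ring_nf
  | succ n ih =>
    rw [show 2 * (n + 1) + 1 = 2 * n + 1 + 1 + 1 by ring, sum_range_succ, sum_range_succ, ih]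
    have hodd : (-1 : ℝ) ^ (2 * n + 1) = -1 := by simp [pow_succ]
    have heven : (-1 : ℝ) ^ (2 * n + 1 + 1) = 1 := by simp [pow_succ]
    simp only [sum_range_succ _ (2 * n + 1 + 1), sum_range_succ _ (2 * n + 1), hodd, heven,
      mul_assoc, prod_cos]
    ring_nf

theorem sum_cos_mul_cos_alternating (n : ℕ) (t : ℝ) (y : Fin (2 * n + 1) → ℝ) :
    ∑ j : Fin (2 * n + 1), (-1) ^ (j : ℕ) * Real.cos (t - y j) *
        Real.cos (∑ i : Fin (2 * n), (-1 : ℝ) ^ (i : ℕ) * y (j.succAbove i)) =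
      Real.cos (t - ∑ j : Fin (2 * n + 1), (-1 : ℝ) ^ (j : ℕ) * y j) := by
  obtain ⟨z, rfl⟩ : ∃ z : ℕ → ℝ, y = fun i : Fin (2 * n + 1) => z i :=
    ⟨fun k => if h : k < 2 * n + 1 then y ⟨k, h⟩ else 0, by ext i; simp only [i.2, dite_true]⟩
  have hskip : ∀ j : Fin (2 * n + 1),
      ∑ i : Fin (2 * n), (-1 : ℝ) ^ (i : ℕ) * z (j.succAbove i) =
        ∑ i ∈ range j, (-1) ^ i * z i + ∑ i ∈ range (j + 1), (-1) ^ i * z i -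
          ∑ i ∈ range (2 * n + 1), (-1) ^ i * z i := by
    intro j
    rw [← sum_alternating_skip z (Nat.le_of_lt_succ j.2),
      ← Fin.sum_univ_eq_sum_range fun i => (-1 : ℝ) ^ i * z (if i < j then i else i + 1)]
    refine sum_congr rfl fun i _ => ?_
    congr 2
    simp only [Fin.succAbove, Fin.lt_def, Fin.val_castSucc]
    split_ifs <;> simp
  simp only [hskip]
  rw [Fin.sum_univ_eq_sum_range fun j => (-1) ^ j * Real.cos (t - z j) *
      Real.cos (∑ i ∈ range j, (-1) ^ i * z i + ∑ i ∈ range (j + 1), (-1) ^ i * z i -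
        ∑ i ∈ range (2 * n + 1), (-1) ^ i * z i),
    Fin.sum_univ_eq_sum_range fun j => (-1) ^ j * z j, sum_cos_telescope]
  ring_nf

/-- Pfaffian of the triangular array `cos (xᵢ - xⱼ)` equals
`cos (x₁ - x₂ + x₃ - ⋯ - x₂ₙ)` (indices here are 0-based). -/
theorem pf_cos (n : ℕ) (hn : 1 ≤ n) (x : Fin (2*n) → ℝ) :
    pf n (fun i j => Real.cos (x i - x j)) =
      Real.cos (∑ i : Fin (2*n), (-1 : ℝ)^(i : ℕ) * x i) := by
  clear hn
  induction n with
  | zero => simp [pf, pfaffPerms]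
  | succ n ih =>
    have hsum : ∑ i : Fin (2 * n + 2), (-1 : ℝ) ^ (i : ℕ) * x i =
        x 0 - ∑ j : Fin (2 * n + 1), (-1 : ℝ) ^ (j : ℕ) * x j.succ := by
      rw [Fin.sum_univ_succ]
      simp [pow_succ, sub_eq_add_neg]
    refine (pf_succ n _).trans (Eq.trans ?_ (congrArg Real.cos hsum.symm))
    rw [← sum_cos_mul_cos_alternating]
    exact sum_congr rfl fun j _ => congrArg _ (ih fun i => x (j.succAbove i).succ)
end

section
/- Let ψ: K × K → K be a symmetric function (ψ(x,y) = ψ(y,x)) satisfying ψ(x+z, y+z) = ψ(x,y) for all x,y,z. Let pf_{2n}(x₁,...,x_{2n}) be the Pfaffian of the triangular array a_{i,j} = ψ(x_i, x_j). Then for any 1 ≤ s ≤ 2n (with x_{2n+1} := x₁), substituting x_{s+1} = x_s yields pf_{2n}(x₁,...,x_{s},x_{s},x_{s+2},...,x_{2n}) = ψ(0,0) · pf_{2n-2}(x₁,...,x_{s-1},x_{s+2},...,x_{2n}), provided char K ≠ 2. -/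
open Finset

instance (m : ℕ) : NeZero (2*(m+1)) := ⟨by omega⟩

namespace Pfaffian

open Equiv

/-- The positions `2k` and `2k + 1`, for `k < n`, as an enumeration of `Fin (2 * n)`. -/
def pos (n : ℕ) : Fin n × Fin 2 ≃ Fin (2 * n) :=
  finProdFinEquiv.trans (finCongr (mul_comm n 2))

lemma pos_val {n : ℕ} (k : Fin n) (c : Fin 2) : (pos n (k, c)).val = 2 * k.val + c.val := by
  simp [pos, add_comm]

lemma mk_two_mul_eq_pos {n : ℕ} (k : Fin n) (h : 2 * k.val < 2 * n) :
    (⟨2 * k.val, h⟩ : Fin (2 * n)) = pos n (k, 0) := by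
  ext; simp [pos_val]

lemma mk_two_mul_add_one_eq_pos {n : ℕ} (k : Fin n) (h : 2 * k.val + 1 < 2 * n) :
    (⟨2 * k.val + 1, h⟩ : Fin (2 * n)) = pos n (k, 1) := by
  ext; simp [pos_val]

lemma mem_pfaffPerms {n : ℕ} {σ : Perm (Fin (2 * n))} :
    σ ∈ pfaffPerms n ↔ (∀ k, σ (pos n (k, 0)) < σ (pos n (k, 1))) ∧
      StrictMono fun k => σ (pos n (k, 0)) := by
  simp [pfaffPerms, mk_two_mul_eq_pos, mk_two_mul_add_one_eq_pos, StrictMono]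

/-- Permutation of the pairs of positions. -/
def blockPerm {n : ℕ} (π : Perm (Fin n)) : Perm (Fin (2 * n)) :=
  (pos n).permCongr (prodCongrLeft fun _ => π)

/-- Permutation of positions inside each pair. -/
def flipPerm {n : ℕ} (c : Fin n → Perm (Fin 2)) : Perm (Fin (2 * n)) :=
  (pos n).permCongr (prodCongrRight c)

/-- The involution exchanging the positions `2k` and `2k + 1`. -/
def partner (n : ℕ) : Perm (Fin (2 * n)) := flipPerm fun _ => swap 0 1

@[simp] lemma blockPerm_pos {n : ℕ} (π : Perm (Fin n)) (k : Fin n) (c : Fin 2) :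
    blockPerm π (pos n (k, c)) = pos n (π k, c) := by
  simp [blockPerm]

@[simp] lemma flipPerm_pos {n : ℕ} (f : Fin n → Perm (Fin 2)) (k : Fin n) (c : Fin 2) :
    flipPerm f (pos n (k, c)) = pos n (k, f k c) := by
  simp [flipPerm]

@[simp] lemma partner_pos {n : ℕ} (k : Fin n) (c : Fin 2) :
    partner n (pos n (k, c)) = pos n (k, swap 0 1 c) := by
  simp [partner]

@[simp] lemma sign_blockPerm {n : ℕ} (π : Perm (Fin n)) : Perm.sign (blockPerm π) = 1 := by
  simp [blockPerm, Perm.sign_prodCongrLeft]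

@[simp] lemma sign_flipPerm {n : ℕ} (f : Fin n → Perm (Fin 2)) :
    Perm.sign (flipPerm f) = ∏ k, Perm.sign (f k) := by
  simp [flipPerm, Perm.sign_prodCongrRight]

lemma ext_pos {n : ℕ} {σ τ : Perm (Fin (2 * n))}
    (h : ∀ k c, σ (pos n (k, c)) = τ (pos n (k, c))) : σ = τ := by
  ext i
  obtain ⟨⟨k, c⟩, rfl⟩ := (pos n).surjective i
  rw [h]

lemma blockPerm_mul_partner {n : ℕ} (π : Perm (Fin n)) :
    blockPerm π * partner n = partner n * blockPerm π :=
  ext_pos fun k c => by simp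

lemma flipPerm_mul_partner {n : ℕ} (f : Fin n → Perm (Fin 2)) :
    flipPerm f * partner n = partner n * flipPerm f := by
  have comm : ∀ a b : Perm (Fin 2), a * b = b * a := by decide
  refine ext_pos fun k c => ?_
  simp only [Perm.mul_apply, partner_pos, flipPerm_pos]
  rw [← Perm.mul_apply, comm, Perm.mul_apply]

/-- The perfect matching, as an involution, which pairs `σ (2k)` with `σ (2k + 1)`. -/
def matching {n : ℕ} (σ : Perm (Fin (2 * n))) : Perm (Fin (2 * n)) := σ * partner n * σ⁻¹

lemma matching_apply {n : ℕ} (σ : Perm (Fin (2 * n))) (k : Fin n) (c : Fin 2) :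
    matching σ (σ (pos n (k, c))) = σ (pos n (k, swap 0 1 c)) := by
  simp [matching]

lemma matching_mul_left {n : ℕ} (π σ : Perm (Fin (2 * n))) :
    matching (π * σ) = π * matching σ * π⁻¹ := by
  simp [matching, mul_assoc]

lemma matching_mul_right {n : ℕ} {σ h : Perm (Fin (2 * n))}
    (hh : h * partner n = partner n * h) : matching (σ * h) = matching σ := by
  simp only [matching, mul_inv_rev, mul_assoc]
  rw [← mul_assoc h, hh]
  simp

lemma matching_matching {n : ℕ} (σ : Perm (Fin (2 * n))) (i : Fin (2 * n)) :
    matching σ (matching σ i) = i := by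
  obtain ⟨j, rfl⟩ := σ.surjective i
  obtain ⟨⟨k, c⟩, rfl⟩ := (pos n).surjective j
  simp [matching_apply]

lemma eq_of_matching_eq {n : ℕ} {σ τ : Perm (Fin (2 * n))} (hσ : σ ∈ pfaffPerms n)
    (hτ : τ ∈ pfaffPerms n) (h : matching σ = matching τ) : σ = τ := by
  have key : ∀ ρ ∈ pfaffPerms n,
      Set.range (fun k => ρ (pos n (k, 0))) = {i | i < matching ρ i} := by
    intro ρ hρ
    rw [mem_pfaffPerms] at hρ
    ext i
    constructor
    · rintro ⟨k, rfl⟩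
      simpa [matching_apply] using hρ.1 k
    · intro hi
      obtain ⟨j, rfl⟩ := ρ.surjective i
      obtain ⟨⟨k, c⟩, rfl⟩ := (pos n).surjective j
      fin_cases c
      · exact ⟨k, rfl⟩
      · have := hρ.1 k
        simp [matching_apply] at hi
        exact absurd hi this.asymm
  have h0 : (fun k => σ (pos n (k, 0))) = fun k => τ (pos n (k, 0)) := by
    rw [← ((mem_pfaffPerms.1 hσ).2).range_inj (mem_pfaffPerms.1 hτ).2, key σ hσ, key τ hτ, h]
  refine ext_pos fun k c => ?_
  fin_cases c
  · exact congrFun h0 k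
  · have h1 := matching_apply σ k 0
    have h2 := matching_apply τ k 0
    have h3 : σ (pos n (k, 0)) = τ (pos n (k, 0)) := congrFun h0 k
    rw [h, h3, h2] at h1
    simpa using h1.symm

variable {R : Type*} [CommRing R]

/-- The antisymmetric matrix with prescribed entries above the diagonal. -/
def antisymm {N : ℕ} (a : Fin N → Fin N → R) (i j : Fin N) : R :=
  if i < j then a i j else if j < i then -a j i else 0

lemma antisymm_swap {N : ℕ} (a : Fin N → Fin N → R) (i j : Fin N) :
    antisymm a j i = -antisymm a i j := by
  unfold antisymm
  rcases lt_trichotomy i j with h | rfl | h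
  · simp [h, h.asymm]
  · simp
  · simp [h, h.asymm]

/-- The signed product attached to a permutation in the expansion of a Pfaffian. -/
def pfTerm {n : ℕ} (B : Fin (2 * n) → Fin (2 * n) → R) (σ : Perm (Fin (2 * n))) : R :=
  ((Perm.sign σ : ℤ) : R) * ∏ k : Fin n, B (σ (pos n (k, 0))) (σ (pos n (k, 1)))

lemma pf_eq_sum_pfTerm {n : ℕ} (a : Fin (2 * n) → Fin (2 * n) → R) :
    pf n a = ∑ σ ∈ pfaffPerms n, pfTerm (antisymm a) σ := by
  refine Finset.sum_congr rfl fun σ hσ => ?_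
  rw [mem_pfaffPerms] at hσ
  simp [pfTerm, mk_two_mul_eq_pos, mk_two_mul_add_one_eq_pos, antisymm, hσ.1]

lemma pfTerm_mul_blockPerm {n : ℕ} (B : Fin (2 * n) → Fin (2 * n) → R)
    (σ : Perm (Fin (2 * n))) (π : Perm (Fin n)) :
    pfTerm B (σ * blockPerm π) = pfTerm B σ := by
  simp only [pfTerm, Perm.mul_apply, blockPerm_pos, Perm.sign_mul, sign_blockPerm, mul_one]
  rw [Equiv.prod_comp π fun k => B (σ (pos n (k, 0))) (σ (pos n (k, 1)))]

lemma pfTerm_mul_flipPerm {n : ℕ} {B : Fin (2 * n) → Fin (2 * n) → R}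
    (hB : ∀ i j, B j i = -B i j) (σ : Perm (Fin (2 * n))) (f : Fin n → Perm (Fin 2)) :
    pfTerm B (σ * flipPerm f) = pfTerm B σ := by
  have h (k : Fin n) : B (σ (pos n (k, f k 0))) (σ (pos n (k, f k 1))) =
      ((Perm.sign (f k) : ℤ) : R) * B (σ (pos n (k, 0))) (σ (pos n (k, 1))) := by
    have hf : ∀ p : Perm (Fin 2), p = 1 ∨ p = swap 0 1 := by decide
    rcases hf (f k) with hk | hk <;> rw [hk]
    · simp
    · simp [hB (σ (pos n (k, 0)))]
  have hs : ((∏ k, ((Perm.sign (f k) : ℤ) : R)) * ∏ k, ((Perm.sign (f k) : ℤ) : R)) = 1 := by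
    rw [← Finset.prod_mul_distrib]
    refine Finset.prod_eq_one fun k _ => ?_
    rcases Int.units_eq_one_or (Perm.sign (f k)) with hk | hk <;> simp [hk]
  simp only [pfTerm, Perm.mul_apply, flipPerm_pos, Perm.sign_mul, sign_flipPerm, h,
    Finset.prod_mul_distrib]
  push_cast
  linear_combination ((Perm.sign σ : ℤ) : R) *
    (∏ k, B (σ (pos n (k, 0))) (σ (pos n (k, 1)))) * hs

lemma exists_pfaffPerm {n : ℕ} (σ : Perm (Fin (2 * n))) :
    ∃ ρ ∈ pfaffPerms n, matching ρ = matching σ ∧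
      ∀ B : Fin (2 * n) → Fin (2 * n) → R, (∀ i j, B j i = -B i j) →
        pfTerm B ρ = pfTerm B σ := by
  set f : Fin n → Perm (Fin 2) := fun k =>
    if σ (pos n (k, 0)) < σ (pos n (k, 1)) then 1 else swap 0 1 with hf
  set τ := σ * flipPerm f with hτ
  have hlt (k : Fin n) : τ (pos n (k, 0)) < τ (pos n (k, 1)) := by
    by_cases h : σ (pos n (k, 0)) < σ (pos n (k, 1))
    · simp [hτ, hf, h]
    · have hne : σ (pos n (k, 1)) ≠ σ (pos n (k, 0)) := by simp
      simpa [hτ, hf, h] using lt_of_le_of_ne (not_lt.1 h) hne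
  set π := Tuple.sort fun k => τ (pos n (k, 0))
  refine ⟨τ * blockPerm π, mem_pfaffPerms.2 ⟨fun k => by simpa using hlt (π k), ?_⟩, ?_, ?_⟩
  · refine Monotone.strictMono_of_injective ?_ fun k l h => by simpa using h
    intro k l hkl
    simpa using Tuple.monotone_sort (fun k => τ (pos n (k, 0))) hkl
  · rw [matching_mul_right (blockPerm_mul_partner π), matching_mul_right (flipPerm_mul_partner f)]
  · intro B hB
    rw [pfTerm_mul_blockPerm, pfTerm_mul_flipPerm hB]

lemma pfTerm_swap_mul {n : ℕ} {B : Fin (2 * n) → Fin (2 * n) → R}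
    (hB : ∀ i j, B j i = -B i j) {s t : Fin (2 * n)} (hst : s ≠ t) {ε : R} (hε : ε * ε = 1)
    (hrow : ∀ j, j ≠ s → j ≠ t → B t j = ε * B s j) {σ : Perm (Fin (2 * n))}
    (hσ : matching σ s ≠ t) : pfTerm B (swap s t * σ) = -pfTerm B σ := by
  set w : Fin (2 * n) → R := fun i => (if i = s then ε else 1) * (if i = t then ε else 1) with hw
  have hw1 : ∏ i, w i = 1 := by
    rw [hw, Finset.prod_mul_distrib]
    simp [hε]
  have hrow' : ∀ j, j ≠ s → j ≠ t → B s j = ε * B t j := by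
    intro j h1 h2
    rw [hrow j h1 h2, ← mul_assoc, hε, one_mul]
  have key (i j : Fin (2 * n)) (hij : i ≠ j) (h1 : ¬(i = s ∧ j = t)) (h2 : ¬(i = t ∧ j = s)) :
      B (swap s t i) (swap s t j) = w i * w j * B i j := by
    by_cases his : i = s
    · subst his
      have hjt : j ≠ t := fun h => h1 ⟨rfl, h⟩
      simp [hw, swap_apply_of_ne_of_ne hij.symm hjt, hst, hij.symm, hjt, hrow j hij.symm hjt]
    by_cases hit : i = t
    · subst hit
      have hjs : j ≠ s := fun h => h2 ⟨rfl, h⟩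
      simp [hw, swap_apply_of_ne_of_ne hjs hij.symm, his, hij.symm, hjs, hrow' j hjs hij.symm]
    by_cases hjs : j = s
    · subst hjs
      rw [swap_apply_of_ne_of_ne his hit, swap_apply_left, hB t i, hB j i, hrow i his hit]
      simp [hw, his, hit, hst]
    by_cases hjt : j = t
    · subst hjt
      rw [swap_apply_of_ne_of_ne his hit, swap_apply_right, hB s i, hB j i, hrow' i his hit]
      simp [hw, his, hit, hjs]
    simp [hw, swap_apply_of_ne_of_ne, his, hit, hjs, hjt]
  have hprod : ∏ k, w (σ (pos n (k, 0))) * w (σ (pos n (k, 1))) = 1 := by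
    rw [← hw1, ← Equiv.prod_comp ((pos n).trans σ) w, Fintype.prod_prod_type]
    simp
  have hfac (k : Fin n) : B (swap s t (σ (pos n (k, 0)))) (swap s t (σ (pos n (k, 1)))) =
      w (σ (pos n (k, 0))) * w (σ (pos n (k, 1))) * B (σ (pos n (k, 0))) (σ (pos n (k, 1))) := by
    refine key _ _ (by simp) ?_ ?_
    · rintro ⟨h1, h2⟩
      refine hσ ?_
      rw [← h1, ← h2, matching_apply, swap_apply_left]
    · rintro ⟨h1, h2⟩
      refine hσ ?_
      rw [← h1, ← h2, matching_apply, swap_apply_right]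
  simp only [pfTerm, Perm.mul_apply, hfac, Finset.prod_mul_distrib (f := fun k => w _ * w _),
    hprod, Perm.sign_mul, Perm.sign_swap hst]
  simp

lemma sum_pfTerm_not_matched {n : ℕ} (h2 : ∀ r : R, r + r = 0 → r = 0)
    {B : Fin (2 * n) → Fin (2 * n) → R} (hB : ∀ i j, B j i = -B i j)
    {s t : Fin (2 * n)} (hst : s ≠ t) {ε : R} (hε : ε * ε = 1)
    (hrow : ∀ j, j ≠ s → j ≠ t → B t j = ε * B s j) :
    ∑ σ ∈ pfaffPerms n with matching σ s ≠ t, pfTerm B σ = 0 := by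
  choose r hr_mem hr_matching hr_term using exists_pfaffPerm (R := R) (n := n)
  have hneg : ∀ σ ∈ (pfaffPerms n).filter (fun σ => matching σ s ≠ t),
      pfTerm B σ + pfTerm B (r (swap s t * σ)) = 0 := by
    intro σ hσ
    rw [hr_term _ B hB, pfTerm_swap_mul hB hst hε hrow (Finset.mem_filter.1 hσ).2, add_neg_cancel]
  refine Finset.sum_involution (fun σ _ => r (swap s t * σ)) hneg ?_ ?_ ?_
  · intro σ hσ hne heq
    have := hneg σ hσ
    rw [heq] at this
    exact hne (h2 _ this)
  · intro σ hσ
    refine Finset.mem_filter.2 ⟨hr_mem _, ?_⟩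
    rw [hr_matching, matching_mul_left]
    have hσ' := (Finset.mem_filter.1 hσ).2
    simp only [Perm.mul_apply, swap_inv, swap_apply_left]
    rw [Ne, swap_apply_eq_iff, swap_apply_right]
    intro h
    exact hσ' (by rw [← h, matching_matching])
  · intro σ hσ
    refine eq_of_matching_eq (hr_mem _) (Finset.mem_filter.1 hσ).1 ?_
    rw [hr_matching, matching_mul_left, hr_matching, matching_mul_left]
    ext i
    simp

/-- The permutation sending `0` and `1` to `p` and `p.succAbove q`, and acting as `τ` on the
remaining indices, enumerated increasingly. -/
def extendPerm {N : ℕ} (p : Fin (N + 2)) (q : Fin (N + 1)) (τ : Perm (Fin N)) :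
    Perm (Fin (N + 2)) :=
  p.cycleRange.symm *
    Perm.decomposeFin.symm (0, q.cycleRange.symm * Perm.decomposeFin.symm (0, τ))

section extendPerm

variable {N : ℕ} (p : Fin (N + 2)) (q : Fin (N + 1)) (τ : Perm (Fin N))

lemma extendPerm_zero : extendPerm p q τ 0 = p := by
  simp [extendPerm]

lemma extendPerm_one : extendPerm p q τ 1 = p.succAbove q := by
  rw [← Fin.succ_zero_eq_one]
  simp [extendPerm, -Fin.succ_zero_eq_one]

lemma extendPerm_succ_succ (i : Fin N) :
    extendPerm p q τ i.succ.succ = p.succAbove (q.succAbove (τ i)) := by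
  simp [extendPerm]

lemma sign_extendPerm :
    Perm.sign (extendPerm p q τ) = (-1) ^ (p.val + q.val) * Perm.sign τ := by
  simp [extendPerm, Fin.sign_cycleRange, pow_add, mul_assoc]

lemma exists_eq_decomposeFin_symm_zero {N : ℕ} {ρ : Perm (Fin (N + 1))} (h : ρ 0 = 0) :
    ∃ τ, ρ = Perm.decomposeFin.symm (0, τ) := by
  obtain ⟨⟨x, τ⟩, rfl⟩ := Perm.decomposeFin.symm.surjective ρ
  rw [Perm.decomposeFin_symm_apply_zero] at h
  exact ⟨τ, by rw [h]⟩

lemma exists_eq_extendPerm {ρ : Perm (Fin (N + 2))} (h0 : ρ 0 = p)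
    (h1 : ρ 1 = p.succAbove q) : ∃ τ, ρ = extendPerm p q τ := by
  obtain ⟨ρ₁, hρ₁⟩ := exists_eq_decomposeFin_symm_zero (ρ := p.cycleRange * ρ) (by simp [h0])
  have h2 : ρ₁ 0 = q := by
    have h : p.cycleRange (ρ 1) = (ρ₁ 0).succ := by
      rw [← Perm.mul_apply, hρ₁, ← Fin.succ_zero_eq_one, Perm.decomposeFin_symm_apply_succ]
      simp
    rw [h1, ← Fin.cycleRange_symm_succ, apply_symm_apply] at h
    exact (Fin.succ_injective _ h).symm
  obtain ⟨τ, hτ⟩ := exists_eq_decomposeFin_symm_zero (ρ := q.cycleRange * ρ₁) (by simp [h2])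
  refine ⟨τ, ?_⟩
  rw [extendPerm, ← hτ]
  ext i
  have : Perm.decomposeFin.symm (0, ρ₁) = p.cycleRange * ρ := hρ₁.symm
  simp [← Perm.inv_def, this]

end extendPerm

section removePair

variable {m : ℕ} (p : Fin (2 * m + 2)) (q : Fin (2 * m + 1)) (τ : Perm (Fin (2 * m)))

lemma pos_zero_zero : pos (m + 1) (0, 0) = (0 : Fin (2 * m + 2)) := Fin.ext (pos_val _ _)

lemma pos_zero_one : pos (m + 1) (0, 1) = (1 : Fin (2 * m + 2)) := Fin.ext (pos_val _ _)

lemma pos_succ (k : Fin m) (c : Fin 2) :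
    pos (m + 1) (k.succ, c) = ((pos m (k, c)).succ.succ : Fin (2 * m + 2)) := by
  refine Fin.ext ?_
  rw [pos_val, Fin.val_succ, Fin.val_succ, Fin.val_succ, pos_val]
  ring

/-- `extendPerm` for permutations of positions. -/
def addPair : Perm (Fin (2 * (m + 1))) := extendPerm p q τ

lemma addPair_pos_zero_zero : addPair p q τ (pos (m + 1) (0, 0)) = p := by
  rw [pos_zero_zero]
  exact extendPerm_zero p q τ

lemma addPair_pos_zero_one : addPair p q τ (pos (m + 1) (0, 1)) = p.succAbove q := by
  rw [pos_zero_one]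
  exact extendPerm_one p q τ

lemma addPair_pos_succ (k : Fin m) (c : Fin 2) :
    addPair p q τ (pos (m + 1) (k.succ, c)) =
      p.succAbove (q.succAbove (τ (pos m (k, c)))) := by
  rw [pos_succ]
  exact extendPerm_succ_succ p q τ _

lemma matching_addPair_left : matching (addPair p q τ) p = p.succAbove q := by
  have h := matching_apply (addPair p q τ) 0 0
  rw [swap_apply_left, addPair_pos_zero_zero, addPair_pos_zero_one] at h
  exact h

lemma matching_addPair_succAbove (i : Fin (2 * m)) :
    matching (addPair p q τ) (p.succAbove (q.succAbove i)) =
      p.succAbove (q.succAbove (matching τ i)) := by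
  obtain ⟨j, rfl⟩ := τ.surjective i
  obtain ⟨⟨k, c⟩, rfl⟩ := (pos m).surjective j
  have h := matching_apply (addPair p q τ) k.succ c
  rw [addPair_pos_succ, addPair_pos_succ] at h
  rw [h, matching_apply]

lemma matching_addPair_congr {τ τ' : Perm (Fin (2 * m))} (h : matching τ = matching τ') :
    matching (addPair p q τ) = matching (addPair p q τ') := by
  refine Equiv.ext fun x => ?_
  obtain rfl | ⟨y, rfl⟩ := Fin.eq_self_or_eq_succAbove p x
  · rw [matching_addPair_left, matching_addPair_left]
  obtain rfl | ⟨i, rfl⟩ := Fin.eq_self_or_eq_succAbove q y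
  · rw [← matching_addPair_left p y τ, matching_matching, matching_addPair_left p y τ,
      ← matching_addPair_left p y τ', matching_matching]
  · rw [matching_addPair_succAbove, matching_addPair_succAbove, h]

lemma matching_addPair_injective {τ τ' : Perm (Fin (2 * m))}
    (h : matching (addPair p q τ) = matching (addPair p q τ')) : matching τ = matching τ' := by
  refine Equiv.ext fun i => ?_
  have := matching_addPair_succAbove p q τ i
  rw [h, matching_addPair_succAbove] at this
  exact (Fin.succAbove_right_injective (Fin.succAbove_right_injective this)).symm

lemma exists_matching_addPair {σ : Perm (Fin (2 * (m + 1)))} (hσ : σ ∈ pfaffPerms (m + 1))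
    (hp : p < p.succAbove q) (h : matching σ p = p.succAbove q) :
    ∃ τ, matching (addPair p q τ) = matching σ := by
  obtain ⟨j, hj⟩ := σ.surjective p
  obtain ⟨⟨k, c⟩, rfl⟩ := (pos (m + 1)).surjective j
  have hc : c = 0 := by
    by_contra hc
    obtain rfl : c = 1 := by omega
    have hlt := (mem_pfaffPerms.1 hσ).1 k
    have := matching_apply σ k 1
    rw [hj, h, swap_apply_right] at this
    rw [← this, hj] at hlt
    exact hlt.asymm hp
  subst hc
  have h1 : σ (pos (m + 1) (k, 1)) = p.succAbove q := by
    rw [← h, ← hj, matching_apply, swap_apply_left]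
  obtain ⟨τ, hτ⟩ := exists_eq_extendPerm (ρ := σ * blockPerm (swap 0 k)) p q
    (by rw [← pos_zero_zero, Perm.mul_apply, blockPerm_pos, swap_apply_left, hj])
    (by rw [← pos_zero_one, Perm.mul_apply, blockPerm_pos, swap_apply_left, h1])
  refine ⟨τ, ?_⟩
  rw [← matching_mul_right (σ := σ) (blockPerm_mul_partner (swap 0 k))]
  exact congrArg matching hτ.symm

lemma pfTerm_addPair (B : Fin (2 * (m + 1)) → Fin (2 * (m + 1)) → R)
    (hpq : Even (p.val + q.val)) :
    pfTerm B (addPair p q τ) = B p (p.succAbove q) *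
      pfTerm (fun i j => B (p.succAbove (q.succAbove i)) (p.succAbove (q.succAbove j))) τ := by
  have hs : Perm.sign (addPair p q τ) = Perm.sign τ := by
    refine (sign_extendPerm p q τ).trans ?_
    rw [hpq.neg_one_pow, one_mul]
  simp only [pfTerm, hs, Fin.prod_univ_succ, addPair_pos_zero_zero, addPair_pos_zero_one,
    addPair_pos_succ]
  ring

lemma sum_pfTerm_matched {B : Fin (2 * (m + 1)) → Fin (2 * (m + 1)) → R}
    (hB : ∀ i j, B j i = -B i j) (hp : p < p.succAbove q) (hpq : Even (p.val + q.val)) :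
    ∑ σ ∈ pfaffPerms (m + 1) with matching σ p = p.succAbove q, pfTerm B σ =
      B p (p.succAbove q) * ∑ τ ∈ pfaffPerms m,
        pfTerm (fun i j => B (p.succAbove (q.succAbove i)) (p.succAbove (q.succAbove j))) τ := by
  choose r hr_mem hr_matching hr_term using exists_pfaffPerm (R := R) (n := m + 1)
  rw [Finset.mul_sum]
  symm
  refine Finset.sum_bij (fun τ _ => r (addPair p q τ)) ?_ ?_ ?_ ?_
  · intro τ _
    refine Finset.mem_filter.2 ⟨hr_mem _, ?_⟩
    rw [hr_matching, matching_addPair_left]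
  · intro τ hτ τ' hτ' h
    refine eq_of_matching_eq hτ hτ' (matching_addPair_injective p q ?_)
    rw [← hr_matching, h, hr_matching]
  · intro σ hσ
    rw [Finset.mem_filter] at hσ
    obtain ⟨τ₀, hτ₀⟩ := exists_matching_addPair p q hσ.1 hp hσ.2
    obtain ⟨τ, hτ, hττ₀, -⟩ := exists_pfaffPerm (R := R) τ₀
    refine ⟨τ, hτ, eq_of_matching_eq (hr_mem _) hσ.1 ?_⟩
    rw [hr_matching, ← hτ₀, matching_addPair_congr p q hττ₀]
  · intro τ _
    rw [hr_term _ B hB, pfTerm_addPair p q τ B hpq]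

lemma antisymm_comp {M N : ℕ} (a : Fin N → Fin N → R) {f : Fin M → Fin N} (hf : StrictMono f)
    (i j : Fin M) : antisymm a (f i) (f j) = antisymm (fun i j => a (f i) (f j)) i j := by
  simp only [antisymm, hf.lt_iff_lt]

/-- If the rows `p` and `p.succAbove q` of an antisymmetric matrix are proportional, with ratio a
square root of `1`, outside the columns `p` and `p.succAbove q`, then the Pfaffian factors. -/
lemma pf_eq_mul_pf (h2 : ∀ r : R, r + r = 0 → r = 0)
    (a : Fin (2 * (m + 1)) → Fin (2 * (m + 1)) → R) (hp : p < p.succAbove q)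
    (hpq : Even (p.val + q.val)) {ε : R} (hε : ε * ε = 1)
    (hrow : ∀ j : Fin (2 * (m + 1)), j ≠ p → j ≠ p.succAbove q →
      antisymm a (p.succAbove q) j = ε * antisymm a p j) :
    pf (m + 1) a = a p (p.succAbove q) *
      pf m (fun i j => a (p.succAbove (q.succAbove i)) (p.succAbove (q.succAbove j))) := by
  have hmono : StrictMono fun i => p.succAbove (q.succAbove i) :=
    (Fin.strictMono_succAbove p).comp (Fin.strictMono_succAbove q)
  rw [pf_eq_sum_pfTerm, pf_eq_sum_pfTerm,
    ← Finset.sum_filter_add_sum_filter_not _ fun σ => matching σ p = p.succAbove q,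
    sum_pfTerm_not_matched h2 (antisymm_swap a) hp.ne hε hrow, add_zero,
    sum_pfTerm_matched p q (antisymm_swap a) hp hpq]
  congr 1
  · exact if_pos hp
  · refine Finset.sum_congr rfl fun τ _ => ?_
    congr 1
    funext i j
    exact antisymm_comp a hmono i j

lemma eq_succAbove_succAbove {e : Fin (2 * m) → Fin (2 * (m + 1))} (he : StrictMono e)
    (hrange : Set.range e = ({p, p.succAbove q} : Set (Fin (2 * m + 2)))ᶜ) (i : Fin (2 * m)) :
    e i = p.succAbove (q.succAbove i) := by
  have hmono : StrictMono fun i => p.succAbove (q.succAbove i) :=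
    (Fin.strictMono_succAbove p).comp (Fin.strictMono_succAbove q)
  refine congrFun ((he.range_inj hmono).1 ?_) i
  refine hrange.trans ?_
  ext x
  obtain rfl | ⟨y, rfl⟩ := Fin.eq_self_or_eq_succAbove p x
  · simp [Fin.succAbove_ne]
  obtain rfl | ⟨i, rfl⟩ := Fin.eq_self_or_eq_succAbove q y
  · simp [Fin.succAbove_ne]
  · simp [Fin.succAbove_ne]

end removePair

end Pfaffian

/-- Let `ψ` be a symmetric translation-invariant function on a field `K` of characteristic
≠ 2, and let `pf₂ₙ(x₁,…,x₂ₙ)` be the Pfaffian of the triangular array `a i j = ψ xᵢ xⱼ`,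
with `n = m+1`. Substituting `x_{s+1} := x_s` (the index `s+1` taken cyclically, so that
`x_{2n+1} := x₁`) yields `ψ 0 0` times the Pfaffian `pf₂ₙ₋₂` of the array on the remaining
`2n-2` indices, enumerated in increasing order by `e`. -/
theorem pf_translation_invariant_collapse (K : Type*) [Field K] (hK : ringChar K ≠ 2)
    (m : ℕ) (ψ : K → K → K)
    (hsymm : ∀ x y, ψ x y = ψ y x)
    (htrans : ∀ x y z, ψ (x + z) (y + z) = ψ x y)
    (x : Fin (2*(m+1)) → K) (s : Fin (2*(m+1)))
    (e : Fin (2*m) → Fin (2*(m+1))) (he : StrictMono e)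
    (hrange : Set.range e = ({s, s + 1} : Set (Fin (2*(m+1))))ᶜ) :
    pf (m+1) (fun i j =>
        ψ (Function.update x (s + 1) (x s) i) (Function.update x (s + 1) (x s) j)) =
      ψ 0 0 * pf m (fun i j => ψ (x (e i)) (x (e j))) := by
  have h2 : ∀ r : K, r + r = 0 → r = 0 := fun r hr => by
    rw [← two_mul] at hr
    exact (mul_eq_zero.1 hr).resolve_left (Ring.two_ne_zero hK)
  have hdiag (z : K) : ψ z z = ψ 0 0 := by simpa using htrans 0 0 z
  set y := Function.update x (s + 1) (x s) with hy
  have hys : y s = x s := by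
    rw [hy, Function.update_apply]
    split_ifs <;> rfl
  have hyt : y (s + 1) = x s := by simp [hy]
  have hye (i : Fin (2 * m)) : y (e i) = x (e i) := by
    have hi : e i ∈ ({s, s + 1} : Set (Fin (2 * (m + 1))))ᶜ := hrange ▸ Set.mem_range_self i
    rw [hy, Function.update_of_ne fun h => hi (Or.inr h)]
  -- It suffices to describe the pair `{s, s + 1}` as `p < p.succAbove q`.
  suffices H : ∃ (p : Fin (2 * m + 2)) (q : Fin (2 * m + 1)) (ε : K),
      p < p.succAbove q ∧ Even (p.val + q.val) ∧ ε * ε = 1 ∧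
      (({p, p.succAbove q} : Set (Fin (2 * (m + 1)))) = {s, s + 1}) ∧
      y p = x s ∧ y (p.succAbove q) = x s ∧
      ∀ j : Fin (2 * (m + 1)), j ≠ p → j ≠ p.succAbove q →
        Pfaffian.antisymm (fun i j => ψ (y i) (y j)) (p.succAbove q) j =
          ε * Pfaffian.antisymm (fun i j => ψ (y i) (y j)) p j by
    obtain ⟨p, q, ε, hp, hpq, hε, hset, h3, h4, hrow⟩ := H
    rw [← hset] at hrange
    rw [Pfaffian.pf_eq_mul_pf p q h2 _ hp hpq hε hrow, h3, h4, hdiag]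
    simp only [← Pfaffian.eq_succAbove_succAbove p q he hrange, hye]
  by_cases hs : s.val = 2 * m + 1
  · have hs1 : s + 1 = 0 := by
      refine Fin.ext ?_
      simp [Fin.val_add, hs, Nat.mul_add]
    have hlast : (0 : Fin (2 * m + 2)).succAbove (Fin.last (2 * m)) = s := by
      refine Fin.ext ?_
      simp [hs]
    rw [hs1] at hyt ⊢
    refine ⟨0, Fin.last (2 * m), -1, ?_, ?_, by ring, ?_, hyt, ?_, ?_⟩
    · rw [Fin.lt_def, hlast, hs]
      exact Nat.succ_pos _
    · simp
    · rw [hlast]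
      exact Set.pair_comm _ _
    · rw [hlast, hys]
    · rw [hlast]
      intro j hj0 hjs
      have h0j : (0 : Fin (2 * (m + 1))) < j := Fin.pos_iff_ne_zero.2 hj0
      have hjs' : j < s := by
        have := Fin.val_ne_of_ne hjs
        have := j.isLt
        rw [Fin.lt_def]
        omega
      change Pfaffian.antisymm _ s j = -1 * Pfaffian.antisymm _ (0 : Fin (2 * (m + 1))) j
      simp [Pfaffian.antisymm, h0j, hjs', hjs'.asymm, hyt, hys, hsymm (x s)]
  · have hlt : s.val < 2 * m + 1 := by
      have := s.isLt
      omega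
    have hs1 : (s + 1).val = s.val + 1 := by
      rw [Fin.val_add, Fin.val_one', Nat.add_mod_mod, Nat.mod_eq_of_lt (by omega)]
    have hsucc : (s : Fin (2 * m + 2)).succAbove ⟨s.val, hlt⟩ = s + 1 := by
      refine Fin.ext ?_
      rw [hs1, Fin.succAbove_of_le_castSucc]
      · rfl
      · exact le_rfl
    refine ⟨s, ⟨s.val, hlt⟩, 1, ?_, ⟨s.val, rfl⟩, by ring, ?_, hys, ?_, ?_⟩
    · rw [hsucc, Fin.lt_def, hs1]
      exact Nat.lt_succ_self _
    · rw [hsucc]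
    · rw [hsucc, hyt]
    · rw [hsucc]
      intro j hjs hjs1
      have h1 : j < s + 1 ↔ j < s := by
        have := Fin.val_ne_of_ne hjs
        rw [Fin.lt_def, Fin.lt_def, hs1]
        omega
      have h3 : s + 1 < j ↔ s < j := by
        have := Fin.val_ne_of_ne hjs1
        rw [Fin.lt_def, Fin.lt_def, hs1] at *
        omega
      simp only [Pfaffian.antisymm, h1, h3, hyt, hys, one_mul]
end
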